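/- The graph K5 minus an edge is plane-maximal 1-planar but not planar-maximal 1-planar: its planar embedding is planar-maximal, yet the removed edge can be added back and drawn planar if a K4 subgraph is drawn as a kite; hence K5 − e admits a 1-planar embedding to which a planar edge can still be added. -/

import Mathlib

open Set

noncomputable section

/-- The Euclidean plane, where graphs are drawn. -/
abbrev Plane : Type := ℝ × ℝ

/-- A drawing of a multigraph on vertex type `V` with edges indexed by `E`,
`ends e` being the (unordered) pair of endpoints of `e`.  Vertices are distinct
points, edges are simple Jordan arcs joining their endpoints, arcs avoid vertices
in their interior, and edges sharing an endpoint do not cross. -/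
structure MultiDrawing (V E : Type) (ends : E → Sym2 V) where
  pos : V → Plane
  pos_inj : Function.Injective pos
  arc : E → ℝ → Plane
  arc_cont : ∀ e, ContinuousOn (arc e) (Icc (0:ℝ) 1)
  arc_inj : ∀ e, InjOn (arc e) (Icc (0:ℝ) 1)
  arc_ends : ∀ e, ∃ u v : V, ends e = s(u, v) ∧ arc e 0 = pos u ∧ arc e 1 = pos v
  arc_avoid : ∀ e, ∀ w : V, pos w ∉ arc e '' Ioo (0:ℝ) 1
  no_incident_cross : ∀ e f, e ≠ f →
    (arc e '' Ioo (0:ℝ) 1 ∩ arc f '' Ioo (0:ℝ) 1).Nonempty →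
    ∀ x : V, ¬(x ∈ ends e ∧ x ∈ ends f)

namespace MultiDrawing

variable {V E : Type} {ends : E → Sym2 V}

/-- The interior (open part) of the arc of edge `e`. -/
def inter (D : MultiDrawing V E ends) (e : E) : Set Plane := D.arc e '' Ioo (0:ℝ) 1

/-- The crossings of edge `e`: pairs of another edge and a common interior point. -/
def crossSet (D : MultiDrawing V E ends) (e : E) : Set (E × Plane) :=
  {fp | fp.1 ≠ e ∧ fp.2 ∈ D.inter e ∩ D.inter fp.1}

/-- A planar drawing: no edge is crossed. -/
def IsPlanarD (D : MultiDrawing V E ends) : Prop := ∀ e, D.crossSet e = ∅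

/-- A 1-planar drawing: each edge is crossed at most once. -/
def IsOnePlanarD (D : MultiDrawing V E ends) : Prop := ∀ e, (D.crossSet e).Subsingleton

/-- The point set occupied by the drawing. -/
def image (D : MultiDrawing V E ends) : Set Plane :=
  range D.pos ∪ ⋃ e, D.arc e '' Icc (0:ℝ) 1

/-- A face of a drawing: a connected component of the complement of its image. -/
def IsFace (D : MultiDrawing V E ends) (F : Set Plane) : Prop :=
  ∃ p, p ∉ D.image ∧ F = connectedComponentIn D.imageᶜ p

/-- A triangulated drawing: the boundary of each face meets (segments of) exactly
three edges. -/
def IsTriangulated (D : MultiDrawing V E ends) : Prop :=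
  ∀ F : Set Plane, D.IsFace F →
    {e : E | (frontier F ∩ D.arc e '' Icc (0:ℝ) 1).Nonempty}.ncard = 3

end MultiDrawing

/-- A drawing of a simple graph: arcs indexed by its edge set. -/
abbrev SimpleGraph.Drawing {V : Type} (G : SimpleGraph V) : Type :=
  MultiDrawing V ↥G.edgeSet (fun e => (e : Sym2 V))

/-- A graph is 1-planar if it has a drawing with at most one crossing per edge. -/
def SimpleGraph.IsOnePlanar {V : Type} (G : SimpleGraph V) : Prop :=
  ∃ D : G.Drawing, D.IsOnePlanarD

/-- A graph is planar if it has a crossing-free drawing. -/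
def SimpleGraph.IsPlanarGraph {V : Type} (G : SimpleGraph V) : Prop :=
  ∃ D : G.Drawing, D.IsPlanarD

/-- Points of the sphere. -/
abbrev SpherePt : Type := ↥(Metric.sphere (0 : EuclideanSpace ℝ (Fin 3)) 1)

/-- A subset of the sphere that is homeomorphic to a closed disk. -/
def IsClosedDisk (s : Set SpherePt) : Prop :=
  Nonempty (↥s ≃ₜ ↥(Metric.closedBall (0 : Plane) 1))

/-- A map: a partition of the sphere into closed-disk regions with pairwise
disjoint interiors, some of which are labeled as countries. -/
structure SphereMap (C : Type) where
  region : C → Set SpherePt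
  country : C → Prop
  disk : ∀ c, IsClosedDisk (region c)
  int_disjoint : ∀ c d : C, c ≠ d → interior (region c) ∩ interior (region d) = ∅
  cover : ⋃ c, region c = Set.univ

/-- A `k`-map: at most `k` regions meet at any point. -/
def SphereMap.IsKMap {C : Type} (M : SphereMap C) (k : ℕ) : Prop :=
  ∀ p : SpherePt, {c : C | p ∈ M.region c}.ncard ≤ k

/-- A hole-free map: every region is a country. -/
def SphereMap.HoleFree {C : Type} (M : SphereMap C) : Prop := ∀ c, M.country c

/-- `G` is the map graph of `M`: its vertices correspond to the countries of `M`,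
with edges given by touching countries. -/
def IsMapGraphOf {V C : Type} (G : SimpleGraph V) (M : SphereMap C) : Prop :=
  ∃ φ : V ≃ {c : C // M.country c},
    ∀ u v : V, G.Adj u v ↔ u ≠ v ∧ (M.region (φ u) ∩ M.region (φ v)).Nonempty

/-- `G` is a map graph. -/
def IsMapGraph {V : Type} (G : SimpleGraph V) : Prop :=
  ∃ (C : Type) (_ : Finite C) (M : SphereMap C), IsMapGraphOf G M

/-- `G` is a `k`-map graph. -/
def IsKMapGraph {V : Type} (G : SimpleGraph V) (k : ℕ) : Prop :=
  ∃ (C : Type) (_ : Finite C) (M : SphereMap C), M.IsKMap k ∧ IsMapGraphOf G M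

/-- `G` is a hole-free `k`-map graph. -/
def IsHoleFreeKMapGraph {V : Type} (G : SimpleGraph V) (k : ℕ) : Prop :=
  ∃ (C : Type) (_ : Finite C) (M : SphereMap C),
    M.HoleFree ∧ M.IsKMap k ∧ IsMapGraphOf G M
/-- `D'` is a drawing of `G` plus the edge `(u,v)` extending the drawing `D` of
`G`: same vertex positions and same arcs on the old edges. -/
def ExtendsBy {V : Type} {G : SimpleGraph V} (D : G.Drawing) (u v : V)
    (D' : (G ⊔ SimpleGraph.fromEdgeSet {s(u, v)}).Drawing) : Prop :=
  D'.pos = D.pos ∧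
  ∀ (e' : (G ⊔ SimpleGraph.fromEdgeSet {s(u, v)}).edgeSet)
    (h : (e' : Sym2 V) ∈ G.edgeSet), ∀ t ∈ Icc (0:ℝ) 1, D'.arc e' t = D.arc ⟨e', h⟩ t

/-- A planar-maximal 1-planar drawing: no new edge can be added to the drawing
and drawn without crossings (keeping 1-planarity). -/
def IsPlanarMaximalD {V : Type} {G : SimpleGraph V} (D : G.Drawing) : Prop :=
  ¬∃ (u v : V) (_ : u ≠ v) (_ : ¬G.Adj u v)
    (D' : (G ⊔ SimpleGraph.fromEdgeSet {s(u, v)}).Drawing),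
      ExtendsBy D u v D' ∧ D'.IsOnePlanarD ∧
      ∀ e' : (G ⊔ SimpleGraph.fromEdgeSet {s(u, v)}).edgeSet,
        (e' : Sym2 V) = s(u, v) → D'.crossSet e' = ∅

/-- The graph `K₅` minus one edge. -/
def K5MinusEdge : SimpleGraph (Fin 5) :=
  (⊤ : SimpleGraph (Fin 5)).deleteEdges {s(0, 1)}

/-- A nowhere vanishing continuous function on the plane has a continuous logarithm. -/
theorem exists_clog {X : Type} [TopologicalSpace X] [SimplyConnectedSpace X]
    [LocallyPathConnectedSpace X] (x₀ : X) (F : X → ℂ) (hF : Continuous F) (h0 : ∀ p, F p ≠ 0) :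
    ∃ L : X → ℂ, Continuous L ∧ ∀ p, Complex.exp (L p) = F p := by
  obtain ⟨L, ⟨-, hL⟩, -⟩ := Complex.isCoveringMapOn_exp.existsUnique_continuousMap_lifts
    (A := X) ⟨F, hF⟩ (a₀ := x₀) (e₀ := Complex.log (F x₀))
    (Complex.exp_log (h0 _)) (fun a => by simpa using h0 a)
  exact ⟨L, L.continuous, fun p => congrFun hL p⟩

/-- Continuous logarithms of proportional paths have the same increment. -/
theorem clog_unique (L L' : ℝ → ℂ) (hL : Continuous L) (hL' : Continuous L') (k : ℂ)
    (h : ∀ t, Complex.exp (L t) = k * Complex.exp (L' t)) : L 1 - L 0 = L' 1 - L' 0 := by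
  obtain ⟨M, -, hM⟩ := Complex.isCoveringMapOn_exp.existsUnique_continuousMap_lifts
    (A := ℝ) ⟨fun t => Complex.exp (L t), by fun_prop⟩ (a₀ := 0) (e₀ := L 0)
    rfl (fun a => by simp)
  have h1 := hM ⟨L, hL⟩ ⟨rfl, rfl⟩
  have h2 := hM ⟨fun t => L' t + (L 0 - L' 0), by fun_prop⟩ ⟨by simp, by
    funext t
    simp only [Function.comp, ContinuousMap.coe_mk]
    have hk := h 0
    rw [Complex.exp_add, Complex.exp_sub, hk, h t]
    field_simp⟩
  have h3 := congrArg (fun f : C(ℝ, ℂ) => f 1) (h1.trans h2.symm)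
  simp only [ContinuousMap.coe_mk] at h3
  rw [h3]; ring

/-- `K₅` has no plane drawing, in terms of arcs parametrised by the real line. -/
theorem k5_arcs_absurd (z : Fin 5 → ℂ) (γ : Fin 5 → Fin 5 → ℝ → ℂ)
    (hc : ∀ a b, a < b → Continuous (γ a b))
    (h0 : ∀ a b, a < b → γ a b 0 = z a) (h1 : ∀ a b, a < b → γ a b 1 = z b)
    (hz : Function.Injective z)
    (hd : ∀ a b c d, a < b → c < d → a ≠ c → a ≠ d → b ≠ c → b ≠ d →
      ∀ s t, γ a b s ≠ γ c d t) : False := by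
  have hav : ∀ u v w, v < w → u ≠ v → u ≠ w → ∀ t, γ v w t - z u ≠ 0 := by
    intro u v w hvw huv huw t
    rw [sub_ne_zero]
    obtain ⟨x, hxu, hxv, hxw⟩ : ∃ x : Fin 5, x ≠ u ∧ x ≠ v ∧ x ≠ w := by
      revert u v w; decide
    rcases lt_or_gt_of_ne hxu with hlt | hlt
    · rw [← h1 x u hlt]
      exact hd _ _ _ _ hvw hlt hxv.symm huv.symm hxw.symm huw.symm _ _
    · rw [← h0 u x hlt]
      exact hd _ _ _ _ hvw hlt huv.symm hxv.symm huw.symm hxw.symm _ _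
  have hA : ∀ u v w, ∃ ℓ : ℝ → ℂ, v < w → u ≠ v → u ≠ w → Continuous ℓ ∧
      ∀ t, Complex.exp (ℓ t) = γ v w t - z u := by
    intro u v w
    by_cases h : v < w ∧ u ≠ v ∧ u ≠ w
    · obtain ⟨L, hL⟩ := exists_clog (0 : ℝ) (fun t => γ v w t - z u)
        ((hc v w h.1).sub continuous_const) (hav u v w h.1 h.2.1 h.2.2)
      exact ⟨L, fun _ _ _ => hL⟩
    · exact ⟨0, fun a b c => absurd ⟨a, b, c⟩ h⟩
  choose ℓ hℓ using hA
  -- the boundary relation of the cell of two disjoint edges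
  have key : ∀ a b c d, a < b → c < d → a ≠ c → a ≠ d → b ≠ c → b ≠ d →
      (ℓ a c d 1 - ℓ a c d 0) + (ℓ d a b 1 - ℓ d a b 0) =
      (ℓ c a b 1 - ℓ c a b 0) + (ℓ b c d 1 - ℓ b c d 0) := by
    intro a b c d hab hcd hac had hbc hbd
    obtain ⟨L, hL, hLF⟩ := exists_clog ((0, 0) : ℝ × ℝ) (fun p => γ c d p.2 - γ a b p.1)
      (((hc c d hcd).comp continuous_snd).sub ((hc a b hab).comp continuous_fst))
      (fun p => sub_ne_zero.2 (hd _ _ _ _ hcd hab hac.symm hbc.symm had.symm hbd.symm _ _))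
    have e1 := clog_unique (fun t => L (0, t)) (ℓ a c d) (by fun_prop) (hℓ a c d hcd hac had).1 1
      (fun t => by rw [hLF, (hℓ a c d hcd hac had).2]; simp [h0 a b hab])
    have e2 := clog_unique (fun t => L (1, t)) (ℓ b c d) (by fun_prop) (hℓ b c d hcd hbc hbd).1 1
      (fun t => by rw [hLF, (hℓ b c d hcd hbc hbd).2]; simp [h1 a b hab])
    have e3 := clog_unique (fun t => L (t, 0)) (ℓ c a b) (by fun_prop)
      (hℓ c a b hab hac.symm hbc.symm).1 (-1)
      (fun t => by rw [hLF, (hℓ c a b hab hac.symm hbc.symm).2]; simp [h0 c d hcd])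
    have e4 := clog_unique (fun t => L (t, 1)) (ℓ d a b) (by fun_prop)
      (hℓ d a b hab had.symm hbd.symm).1 (-1)
      (fun t => by rw [hLF, (hℓ d a b hab had.symm hbd.symm).2]; simp [h1 c d hcd])
    rw [← e1, ← e2, ← e3, ← e4]; ring
  -- reference angles
  obtain ⟨θ, hθ, hθs⟩ : ∃ θ : Fin 5 → Fin 5 → ℂ, (∀ u v, u ≠ v → Complex.exp (θ u v) = z v - z u) ∧
      ∀ u v, u < v → θ v u = θ u v + Real.pi * Complex.I := by
    refine ⟨fun u v => if u < v then Complex.log (z v - z u)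
      else Complex.log (z u - z v) + Real.pi * Complex.I, ?_, ?_⟩
    · intro u v huv
      have hne : z v - z u ≠ 0 := sub_ne_zero.2 (hz.ne huv.symm)
      have hne' : z u - z v ≠ 0 := sub_ne_zero.2 (hz.ne huv)
      dsimp only
      split_ifs
      · exact Complex.exp_log hne
      · rw [Complex.exp_add, Complex.exp_log hne', Complex.exp_pi_mul_I]; ring
    · intro u v huv
      simp [huv, huv.not_gt]
  have hn : ∀ u v w, ∃ n : ℤ, v < w → u ≠ v → u ≠ w →
      ℓ u v w 1 - ℓ u v w 0 = θ u w - θ u v + n * (2 * Real.pi * Complex.I) := by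
    intro u v w
    by_cases h : v < w ∧ u ≠ v ∧ u ≠ w
    · obtain ⟨hvw, huv, huw⟩ := h
      have : Complex.exp (ℓ u v w 1 - ℓ u v w 0) = Complex.exp (θ u w - θ u v) := by
        rw [Complex.exp_sub, Complex.exp_sub, hθ u w huw, hθ u v huv, (hℓ u v w hvw huv huw).2,
          (hℓ u v w hvw huv huw).2, h0 v w hvw, h1 v w hvw]
      obtain ⟨n, hn⟩ := Complex.exp_eq_exp_iff_exists_int.1 this
      exact ⟨n, fun _ _ _ => hn⟩
    · exact ⟨0, fun a b c => absurd ⟨a, b, c⟩ h⟩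
  choose n hn using hn
  have hpi : (Real.pi * Complex.I : ℂ) ≠ 0 := by simp [Real.pi_ne_zero]
  have fin : ∀ x y : ℤ, (x : ℂ) * (Real.pi * Complex.I) = y * (Real.pi * Complex.I) → x = y := by
    intro x y h
    exact_mod_cast mul_right_cancel₀ hpi h
  have key' : ∀ a b c d, a < b → c < d → a ≠ c → a ≠ d → b ≠ c → b ≠ d → _ :=
    fun a b c d hab hcd hac had hbc hbd => by
      have k := key a b c d hab hcd hac had hbc hbd
      rw [hn a c d hcd hac had, hn d a b hab had.symm hbd.symm, hn c a b hab hac.symm hbc.symm,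
        hn b c d hcd hbc hbd] at k
      exact k
  -- separated, nested and interleaved pairs of edges
  have sep : ∀ a b c d, a < b → b < c → c < d →
      n a c d + n d a b = n c a b + n b c d := by
    intro a b c d hab hbc hcd
    have k := key' a b c d hab hcd (hab.trans hbc).ne (hab.trans (hbc.trans hcd)).ne hbc.ne
      (hbc.trans hcd).ne
    rw [hθs a d (hab.trans (hbc.trans hcd)), hθs b d (hbc.trans hcd), hθs a c (hab.trans hbc),
      hθs b c hbc] at k
    have := fin (2 * (n a c d + n d a b)) (2 * (n c a b + n b c d))
      (by push_cast; linear_combination k)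
    omega
  have nest : ∀ a c d b, a < c → c < d → d < b →
      n a c d + n d a b = n c a b + n b c d := by
    intro a c d b hac hcd hdb
    have k := key' a b c d (hac.trans (hcd.trans hdb)) hcd hac.ne (hac.trans hcd).ne
      (hcd.trans hdb).ne' hdb.ne'
    rw [hθs a d (hac.trans hcd), hθs d b hdb, hθs a c hac,
      hθs c b (hcd.trans hdb)] at k
    have := fin (2 * (n a c d + n d a b)) (2 * (n c a b + n b c d))
      (by push_cast; linear_combination k)
    omega
  have cross : ∀ a c b d, a < c → c < b → b < d →
      n a c d + n d a b + 1 = n c a b + n b c d ∨ n a c d + n d a b - 1 = n c a b + n b c d := by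
    intro a c b d hac hcb hbd
    have k := key' a b c d (hac.trans hcb) (hcb.trans hbd) hac.ne (hac.trans (hcb.trans hbd)).ne
      hcb.ne' hbd.ne
    rw [hθs a d (hac.trans (hcb.trans hbd)), hθs b d hbd, hθs a c hac,
      hθs c b hcb] at k
    have := fin (2 * (n a c d + n d a b + 1)) (2 * (n c a b + n b c d))
      (by push_cast; linear_combination k)
    omega
  have a1 := sep 0 1 2 3 (by decide) (by decide) (by decide)
  have a2 := sep 0 1 2 4 (by decide) (by decide) (by decide)
  have a3 := sep 0 1 3 4 (by decide) (by decide) (by decide)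
  have a4 := sep 0 2 3 4 (by decide) (by decide) (by decide)
  have a5 := sep 1 2 3 4 (by decide) (by decide) (by decide)
  have b1 := nest 0 1 2 3 (by decide) (by decide) (by decide)
  have b2 := nest 0 1 2 4 (by decide) (by decide) (by decide)
  have b3 := nest 0 1 3 4 (by decide) (by decide) (by decide)
  have b4 := nest 0 2 3 4 (by decide) (by decide) (by decide)
  have b5 := nest 1 2 3 4 (by decide) (by decide) (by decide)
  have c1 := cross 0 1 2 3 (by decide) (by decide) (by decide)
  have c2 := cross 0 1 2 4 (by decide) (by decide) (by decide)
  have c3 := cross 0 1 3 4 (by decide) (by decide) (by decide)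
  have c4 := cross 0 2 3 4 (by decide) (by decide) (by decide)
  have c5 := cross 1 2 3 4 (by decide) (by decide) (by decide)
  have par : ∀ x y : ℤ, (x + 1 = y ∨ x - 1 = y) → ∃ m, y = x + 1 + 2 * m := by
    rintro x y (h | h)
    · exact ⟨0, by omega⟩
    · exact ⟨-1, by omega⟩
  obtain ⟨m1, c1⟩ := par _ _ c1
  obtain ⟨m2, c2⟩ := par _ _ c2
  obtain ⟨m3, c3⟩ := par _ _ c3
  obtain ⟨m4, c4⟩ := par _ _ c4
  obtain ⟨m5, c5⟩ := par _ _ c5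
  omega

/-- Every point of an arc is interior or a vertex incident to the edge. -/
theorem arc_cases {V E : Type} {ends : E → Sym2 V} (D : MultiDrawing V E ends) (e : E) (t : ℝ)
    (ht : t ∈ Icc (0:ℝ) 1) :
    D.arc e t ∈ D.inter e ∨ ∃ u ∈ ends e, D.arc e t = D.pos u := by
  obtain ⟨u, v, h, h0, h1⟩ := D.arc_ends e
  rcases eq_or_lt_of_le ht.1 with h | hl
  · right; subst h; exact ⟨u, by simp [*], h0⟩
  rcases eq_or_lt_of_le ht.2 with h | hr
  · right; subst h; exact ⟨v, by simp [*], h1⟩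
  · exact Or.inl ⟨t, ⟨hl, hr⟩, rfl⟩

/-- In a planar drawing, vertex-disjoint edges have disjoint closed arcs. -/
theorem arcs_disjoint {V E : Type} {ends : E → Sym2 V} (D : MultiDrawing V E ends)
    (hD : D.IsPlanarD) (e f : E) (hef : ∀ x, x ∈ ends e → x ∉ ends f) (s t : ℝ)
    (hs : s ∈ Icc (0:ℝ) 1) (ht : t ∈ Icc (0:ℝ) 1) : D.arc e s ≠ D.arc f t := by
  intro h
  rcases arc_cases D e s hs with h1 | ⟨u, hu, h1⟩ <;> rcases arc_cases D f t ht with h2 | ⟨v, hv, h2⟩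
  · have : ((f, D.arc e s) : E × Plane) ∈ D.crossSet e := by
      refine ⟨fun hfe : f = e => ?_, h1, h ▸ h2⟩
      obtain ⟨u, v, h, -⟩ := D.arc_ends f
      exact hef u (by simp [← hfe, h]) (by simp [h])
    rw [hD e] at this
    exact this
  · exact D.arc_avoid e v (by rw [← h2, ← h]; exact h1)
  · exact D.arc_avoid f u (by rw [← h1, h]; exact h2)
  · have := D.pos_inj (h1.symm.trans (h.trans h2))
    subst this
    exact hef _ hu hv

/-- A graph on five vertices with all edges has no planar drawing. -/
theorem k5_not_planar (G : SimpleGraph (Fin 5)) (hG : ∀ a b, a ≠ b → G.Adj a b) (D : G.Drawing)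
    (hD : D.IsPlanarD) : False := by
  have hg : ∀ a b : Fin 5, ∃ g : ℝ → Plane, ∀ h : a < b, Continuous g ∧ g 0 = D.pos a ∧
      g 1 = D.pos b ∧ ∀ t, ∃ s ∈ Icc (0:ℝ) 1, g t = D.arc ⟨s(a, b), hG a b h.ne⟩ s := by
    intro a b
    by_cases h : a < b
    · have cont : Continuous (fun t : ℝ => D.arc ⟨s(a, b), hG a b h.ne⟩ (projIcc 0 1 zero_le_one t)) :=
        (D.arc_cont _).comp_continuous (continuous_subtype_val.comp continuous_projIcc)
          (fun t => (projIcc 0 1 zero_le_one t).2)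
      obtain ⟨u, v, huv, h0, h1⟩ := D.arc_ends ⟨s(a, b), hG a b h.ne⟩
      rcases Sym2.eq_iff.1 huv with ⟨rfl, rfl⟩ | ⟨rfl, rfl⟩
      · refine ⟨_, fun _ => ⟨cont, ?_, ?_, fun t => ⟨_, (projIcc 0 1 zero_le_one t).2, rfl⟩⟩⟩
        · simpa using h0
        · simpa using h1
      · refine ⟨_, fun _ => ⟨cont.comp (continuous_const.sub continuous_id : Continuous fun t : ℝ => 1 - t),
          ?_, ?_, fun t => ⟨_, (projIcc 0 1 zero_le_one (1 - t)).2, rfl⟩⟩⟩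
        · simpa using h1
        · simpa using h0
    · exact ⟨0, fun h' => absurd h' h⟩
  choose g hg using hg
  let φ := Complex.equivRealProdCLM.symm
  refine k5_arcs_absurd (fun v => φ (D.pos v)) (fun a b t => φ (g a b t)) ?_ ?_ ?_ ?_ ?_
  · intro a b h; exact φ.continuous.comp (hg a b h).1
  · intro a b h; simp [(hg a b h).2.1]
  · intro a b h; simp [(hg a b h).2.2.1]
  · exact φ.injective.comp D.pos_inj
  · intro a b c d hab hcd hac had hbc hbd s t h
    have h := φ.injective h
    obtain ⟨s', hs, es⟩ := (hg a b hab).2.2.2 s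
    obtain ⟨t', ht, et⟩ := (hg c d hcd).2.2.2 t
    rw [es, et] at h
    refine arcs_disjoint D hD _ _ ?_ _ _ hs ht h
    intro x hx hx'
    simp only [Sym2.mem_iff] at hx hx'
    rcases hx with rfl | rfl <;> rcases hx' with rfl | rfl <;> contradiction

theorem k5e_adj (u v : Fin 5) : K5MinusEdge.Adj u v ↔ u ≠ v ∧ s(u, v) ≠ s(0, 1) := by
  simp [K5MinusEdge, SimpleGraph.deleteEdges_adj]

/-- Planar drawings of `K₅ − e` are planar-maximal. -/
theorem planar_maximal (D : K5MinusEdge.Drawing) (hD : D.IsPlanarD) : IsPlanarMaximalD D := by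
  rintro ⟨u, v, huv, hadj, D', ⟨hpos, harc⟩, -, hnew⟩
  have he : s(u, v) = s(0, 1) := by
    by_contra h
    exact hadj ((k5e_adj u v).2 ⟨huv, h⟩)
  refine k5_not_planar _ ?_ D' ?_
  · intro a b hab
    rw [SimpleGraph.sup_adj, k5e_adj, SimpleGraph.fromEdgeSet_adj, he]
    by_cases h : s(a, b) = s(0, 1)
    · exact Or.inr ⟨h, hab⟩
    · exact Or.inl ⟨hab, h⟩
  · intro e
    rw [Set.eq_empty_iff_forall_notMem]
    rintro ⟨f, p⟩ ⟨hfe, hpe, hpf⟩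
    have old : ∀ x : ↥(K5MinusEdge ⊔ SimpleGraph.fromEdgeSet {s(u, v)}).edgeSet,
        (x : Sym2 (Fin 5)) ≠ s(u, v) → (x : Sym2 (Fin 5)) ∈ K5MinusEdge.edgeSet := by
      rintro ⟨x, hx⟩ hne
      rw [SimpleGraph.edgeSet_sup] at hx
      rcases hx with hx | hx
      · exact hx
      · rw [SimpleGraph.edgeSet_fromEdgeSet] at hx
        exact absurd hx.1 hne
    by_cases h1 : (e : Sym2 (Fin 5)) = s(u, v)
    · have : (f, p) ∈ D'.crossSet e := ⟨hfe, hpe, hpf⟩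
      rw [hnew e h1] at this
      exact this
    by_cases h2 : (f : Sym2 (Fin 5)) = s(u, v)
    · have : (e, p) ∈ D'.crossSet f := ⟨Ne.symm hfe, hpf, hpe⟩
      rw [hnew f h2] at this
      exact this
    have tr : ∀ (x : ↥(K5MinusEdge ⊔ SimpleGraph.fromEdgeSet {s(u, v)}).edgeSet)
        (hx : (x : Sym2 (Fin 5)) ∈ K5MinusEdge.edgeSet), p ∈ D'.inter x →
        p ∈ D.inter ⟨x, hx⟩ := by
      rintro x hx ⟨t, ht, rfl⟩
      exact ⟨t, ht, (harc x hx t (Ioo_subset_Icc_self ht)).symm⟩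
    have : ((⟨f, old f h2⟩, p) : ↥K5MinusEdge.edgeSet × Plane) ∈ D.crossSet ⟨e, old e h1⟩ :=
      ⟨fun h => hfe (Subtype.ext (Subtype.mk.inj h)), tr _ _ hpe, tr _ _ hpf⟩
    rw [hD] at this
    exact this

/-! ### Straight-line drawings -/

/-- Orientation determinant of three integer points. -/
def orient (P : Fin 5 → ℤ × ℤ) (a b c : Fin 5) : ℤ :=
  ((P b).1 - (P a).1) * ((P c).2 - (P a).2) - ((P b).2 - (P a).2) * ((P c).1 - (P a).1)

/-- Integer points `c`, `d` do not lie strictly on the same side of the line `ab`. -/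
def notSame (P : Fin 5 → ℤ × ℤ) (a b c d : Fin 5) : Prop :=
  (orient P a b c = 0 ∧ orient P a b d = 0) ∨ orient P a b c * orient P a b d < 0

instance (P : Fin 5 → ℤ × ℤ) (a b c d : Fin 5) : Decidable (notSame P a b c d) :=
  inferInstanceAs (Decidable (_ ∨ _))

/-- The segment between points `a` and `b`. -/
def seg (P : Fin 5 → ℤ × ℤ) (a b : Fin 5) (t : ℝ) : Plane :=
  ((1 - t) * (P a).1 + t * (P b).1, (1 - t) * (P a).2 + t * (P b).2)

theorem seg_orient (P : Fin 5 → ℤ × ℤ) (a b c d : Fin 5) (s t : ℝ)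
    (h : seg P a b s = seg P c d t) :
    (1 - t) * (orient P a b c : ℝ) + t * (orient P a b d : ℝ) = 0 := by
  simp only [seg, Prod.mk.injEq] at h
  obtain ⟨h1, h2⟩ := h
  simp only [orient]
  push_cast
  linear_combination (((P b).2 : ℝ) - (P a).2) * h1 - (((P b).1 : ℝ) - (P a).1) * h2

theorem notSame_of_comb (x y : ℤ) (t : ℝ) (ht : t ∈ Ioo (0:ℝ) 1)
    (h : (1 - t) * (x : ℝ) + t * (y : ℝ) = 0) : (x = 0 ∧ y = 0) ∨ x * y < 0 := by
  obtain ⟨h0, h1⟩ := ht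
  rcases lt_trichotomy x 0 with hx | hx | hx
  · right
    have hx' : (x : ℝ) < 0 := by exact_mod_cast hx
    have : (0 : ℝ) < y := by
      by_contra hy
      nlinarith [mul_pos_of_neg_of_neg (sub_neg.2 h1) hx']
    exact mul_neg_of_neg_of_pos hx (by exact_mod_cast this)
  · left
    subst hx
    refine ⟨rfl, ?_⟩
    have : (y : ℝ) = 0 := by
      simpa [h0.ne'] using h
    exact_mod_cast this
  · right
    have hx' : (0 : ℝ) < x := by exact_mod_cast hx
    have : (y : ℝ) < 0 := by
      by_contra hy
      nlinarith [mul_pos (sub_pos.2 h1) hx']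
    exact mul_neg_of_pos_of_neg hx (by exact_mod_cast this)

theorem seg_cross (P : Fin 5 → ℤ × ℤ) (a b c d : Fin 5) (s t : ℝ) (hs : s ∈ Ioo (0:ℝ) 1)
    (ht : t ∈ Ioo (0:ℝ) 1) (h : seg P a b s = seg P c d t) :
    notSame P a b c d ∧ notSame P c d a b :=
  ⟨notSame_of_comb _ _ t ht (seg_orient P a b c d s t h),
    notSame_of_comb _ _ s hs (seg_orient P c d a b t s h.symm)⟩

theorem seg_inj (P : Fin 5 → ℤ × ℤ) (hP : Function.Injective P) (a b : Fin 5) (hab : a ≠ b)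
    (s t : ℝ) (h : seg P a b s = seg P a b t) : s = t := by
  simp only [seg, Prod.mk.injEq] at h
  obtain ⟨h1, h2⟩ := h
  by_contra hst
  have hst' : s - t ≠ 0 := sub_ne_zero.2 hst
  have e1 : ((P b).1 : ℝ) = (P a).1 := by
    apply sub_eq_zero.1
    apply mul_left_cancel₀ hst'
    linear_combination h1
  have e2 : ((P b).2 : ℝ) = (P a).2 := by
    apply sub_eq_zero.1
    apply mul_left_cancel₀ hst'
    linear_combination h2
  exact hab (hP (Prod.ext (by exact_mod_cast e1.symm) (by exact_mod_cast e2.symm)))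

theorem sym2_inf_sup (e : Sym2 (Fin 5)) : s(e.inf, e.sup) = e := by
  induction e with
  | h a b =>
    rcases le_total a b with h | h
    · simp [h]
    · simp [h, Sym2.eq_swap]

theorem edge_lt (G : SimpleGraph (Fin 5)) (e : G.edgeSet) :
    (e : Sym2 (Fin 5)).inf < (e : Sym2 (Fin 5)).sup := by
  refine lt_of_le_of_ne (Sym2.inf_le_sup _) ?_
  have h := e.2
  rw [← sym2_inf_sup e.1, SimpleGraph.mem_edgeSet] at h
  exact h.ne

/-- The straight-line drawing of a graph with integer vertex positions in general position. -/
def straight (G : SimpleGraph (Fin 5)) (P : Fin 5 → ℤ × ℤ) (hP : Function.Injective P)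
    (hg : ∀ a b c, a ≠ b → a ≠ c → b ≠ c → orient P a b c ≠ 0)
    (hX : ∀ a b c d, a < b → c < d → ¬(a = c ∧ b = d) → notSame P a b c d → notSame P c d a b →
      a ≠ c ∧ a ≠ d ∧ b ≠ c ∧ b ≠ d) : G.Drawing where
  pos v := ((P v).1, (P v).2)
  pos_inj := by
    intro a b h
    simp only [Prod.mk.injEq, Int.cast_inj] at h
    exact hP (Prod.ext h.1 h.2)
  arc e := seg P (e : Sym2 (Fin 5)).inf (e : Sym2 (Fin 5)).sup
  arc_cont e := by
    apply Continuous.continuousOn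
    unfold seg
    fun_prop
  arc_inj e := fun s _ t _ h => seg_inj P hP _ _ (edge_lt G e).ne s t h
  arc_ends e := ⟨_, _, (sym2_inf_sup e.1).symm, by simp [seg], by simp [seg]⟩
  arc_avoid e w := by
    rintro ⟨t, ht, h⟩
    have hlt := edge_lt G e
    generalize (e : Sym2 (Fin 5)).inf = a at *
    generalize (e : Sym2 (Fin 5)).sup = b at *
    by_cases ha : a = w
    · subst ha
      have := seg_inj P hP a b hlt.ne t 0 (h.trans (by simp [seg]))
      exact ht.1.ne' this
    by_cases hb : b = w
    · subst hb
      have := seg_inj P hP a b hlt.ne t 1 (h.trans (by simp [seg]))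
      exact ht.2.ne this
    have := seg_orient P a b w w t 0 (h.trans (by simp [seg]))
    simp at this
    exact hg a b w hlt.ne ha hb this
  no_incident_cross e f hef := by
    rintro ⟨p, ⟨s, hs, h1⟩, ⟨t, ht, h2⟩⟩ x ⟨hxe, hxf⟩
    obtain ⟨c1, c2⟩ := seg_cross P _ _ _ _ s t hs ht (h1.trans h2.symm)
    have := hX _ _ _ _ (edge_lt G e) (edge_lt G f)
      (fun h => hef (Subtype.ext (Sym2.inf_eq_inf_and_sup_eq_sup.1 h))) c1 c2
    rw [← sym2_inf_sup e.1] at hxe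
    rw [← sym2_inf_sup f.1] at hxf
    simp only [Sym2.mem_iff] at hxe hxf
    obtain ⟨h1, h2, h3, h4⟩ := this
    rcases hxe with rfl | rfl <;> rcases hxf with h | h <;> contradiction

/-- Crossings of a straight-line drawing, in combinatorial terms. -/
theorem straight_cross (G : SimpleGraph (Fin 5)) (P : Fin 5 → ℤ × ℤ) (hP hg hX) (e f : G.edgeSet)
    (p : Plane) (h : (f, p) ∈ (straight G P hP hg hX).crossSet e) :
    ¬((e : Sym2 (Fin 5)).inf = (f : Sym2 (Fin 5)).inf ∧
      (e : Sym2 (Fin 5)).sup = (f : Sym2 (Fin 5)).sup) ∧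
    notSame P (e : Sym2 (Fin 5)).inf (e : Sym2 (Fin 5)).sup
      (f : Sym2 (Fin 5)).inf (f : Sym2 (Fin 5)).sup ∧
    notSame P (f : Sym2 (Fin 5)).inf (f : Sym2 (Fin 5)).sup
      (e : Sym2 (Fin 5)).inf (e : Sym2 (Fin 5)).sup ∧
    ∃ t : ℝ, p = seg P (f : Sym2 (Fin 5)).inf (f : Sym2 (Fin 5)).sup t ∧
      (1 - t) * (orient P (e : Sym2 (Fin 5)).inf (e : Sym2 (Fin 5)).sup (f : Sym2 (Fin 5)).inf : ℝ)
      + t * (orient P (e : Sym2 (Fin 5)).inf (e : Sym2 (Fin 5)).sup (f : Sym2 (Fin 5)).sup : ℝ)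
        = 0 := by
  obtain ⟨hne, ⟨s, hs, h1⟩, ⟨t, ht, h2⟩⟩ := h
  have heq := h1.trans h2.symm
  obtain ⟨c1, c2⟩ := seg_cross P _ _ _ _ s t hs ht heq
  exact ⟨fun h => hne (Subtype.ext (Sym2.inf_eq_inf_and_sup_eq_sup.1 h)).symm, c1, c2,
    t, h2.symm, seg_orient P _ _ _ _ s t heq⟩

/-- Positions whose only crossing is between `01` and `34`. -/
def P₁ : Fin 5 → ℤ × ℤ := ![(6, 2), (6, 13), (0, 0), (12, 0), (5, 6)]

/-- Positions whose only crossing is between `12` and `34`. -/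
def P₂ : Fin 5 → ℤ × ℤ := ![(0, 0), (6, 13), (6, 2), (12, 0), (5, 6)]

theorem P₁_cross : ∀ a b c d : Fin 5, a < b → c < d → ¬(a = c ∧ b = d) → notSame P₁ a b c d →
    notSame P₁ c d a b → (a = 0 ∧ b = 1 ∧ c = 3 ∧ d = 4) ∨ (a = 3 ∧ b = 4 ∧ c = 0 ∧ d = 1) := by
  decide

theorem P₂_cross : ∀ a b c d : Fin 5, a < b → c < d → ¬(a = c ∧ b = d) → notSame P₂ a b c d →
    notSame P₂ c d a b → (a = 1 ∧ b = 2 ∧ c = 3 ∧ d = 4) ∨ (a = 3 ∧ b = 4 ∧ c = 1 ∧ d = 2) := by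
  decide

/-- A planar drawing of `K₅ − e`. -/
def D₁ : K5MinusEdge.Drawing :=
  straight K5MinusEdge P₁ (by decide) (by decide) (by
    intro a b c d h1 h2 h3 h4 h5
    rcases P₁_cross a b c d h1 h2 h3 h4 h5 with ⟨rfl, rfl, rfl, rfl⟩ | ⟨rfl, rfl, rfl, rfl⟩ <;>
      decide)

theorem D₁_planar : D₁.IsPlanarD := by
  intro e
  rw [Set.eq_empty_iff_forall_notMem]
  rintro ⟨f, p⟩ h
  obtain ⟨h1, h2, h3, -⟩ := straight_cross _ _ _ _ _ e f p h
  have no : ∀ x : K5MinusEdge.edgeSet, ¬((x : Sym2 (Fin 5)).inf = 0 ∧ (x : Sym2 (Fin 5)).sup = 1) := by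
    rintro ⟨x, hx⟩ ⟨h0, h1⟩
    rw [← sym2_inf_sup x, SimpleGraph.mem_edgeSet, k5e_adj] at hx
    simp only at h0 h1
    rw [h0, h1] at hx
    exact hx.2 rfl
  rcases P₁_cross _ _ _ _ (edge_lt _ e) (edge_lt _ f) h1 h2 h3 with h | h
  · exact no e ⟨h.1, h.2.1⟩
  · exact no f ⟨h.2.2.1, h.2.2.2⟩

/-- A straight-line drawing with one crossing (between `12` and `34`). -/
def D₂ (G : SimpleGraph (Fin 5)) : G.Drawing :=
  straight G P₂ (by decide) (by decide) (by
    intro a b c d h1 h2 h3 h4 h5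
    rcases P₂_cross a b c d h1 h2 h3 h4 h5 with ⟨rfl, rfl, rfl, rfl⟩ | ⟨rfl, rfl, rfl, rfl⟩ <;>
      decide)

theorem D₂_onePlanar (G : SimpleGraph (Fin 5)) : (D₂ G).IsOnePlanarD := by
  rintro e ⟨f, p⟩ h ⟨f', p'⟩ h'
  obtain ⟨h1, h2, h3, t, rfl, ht⟩ := straight_cross _ _ _ _ _ e f p h
  obtain ⟨h1', h2', h3', t', rfl, ht'⟩ := straight_cross _ _ _ _ _ e f' p' h'
  have c := P₂_cross _ _ _ _ (edge_lt _ e) (edge_lt _ f) h1 h2 h3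
  have c' := P₂_cross _ _ _ _ (edge_lt _ e) (edge_lt _ f') h1' h2' h3'
  have hff : f = f' := by
    apply Subtype.ext
    apply Sym2.inf_eq_inf_and_sup_eq_sup.1
    rcases c with c | c <;> rcases c' with c' | c'
    · simp [c, c']
    · simp [c.1] at c'
    · simp [c.1] at c'
    · simp [c, c']
  subst hff
  have o1 : orient P₂ 1 2 3 = 66 := by decide
  have o2 : orient P₂ 1 2 4 = -11 := by decide
  have o3 : orient P₂ 3 4 1 = -55 := by decide
  have o4 : orient P₂ 3 4 2 = 22 := by decide
  have htt : t = t' := by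
    rcases c with ⟨e1, e2, e3, e4⟩ | ⟨e1, e2, e3, e4⟩
    all_goals
      rw [e1, e2, e3, e4] at ht ht'
      simp only [o1, o2, o3, o4] at ht ht'
      push_cast at ht ht'
      linarith
  rw [htt]

theorem D₂_not_maximal : ¬IsPlanarMaximalD (D₂ K5MinusEdge) := by
  intro h
  apply h
  refine ⟨0, 1, by decide, by rw [k5e_adj]; simp, D₂ _, ⟨rfl, fun _ _ _ _ => rfl⟩,
    D₂_onePlanar _, ?_⟩
  intro e he
  rw [Set.eq_empty_iff_forall_notMem]
  rintro ⟨f, p⟩ hf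
  obtain ⟨h1, h2, h3, -⟩ := straight_cross _ _ _ _ _ e f p hf
  rcases P₂_cross _ _ _ _ (edge_lt _ e) (edge_lt _ f) h1 h2 h3 with h | h
  · have := h.1
    simp [he] at this
  · have := h.1
    simp [he] at this

/-- `K₅ − e` is plane-maximal 1-planar (it has a planar-maximal
1-planar embedding — indeed its planar embedding is planar-maximal) but not
planar-maximal 1-planar: it also admits a 1-planar embedding (with a `K₄` drawn
as a kite) to which a planar edge can still be added. -/
theorem k5_minus_e_plane_maximal_not_planar_maximal :
    (∃ D : K5MinusEdge.Drawing, D.IsOnePlanarD ∧ IsPlanarMaximalD D) ∧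
    (∀ D : K5MinusEdge.Drawing, D.IsPlanarD → IsPlanarMaximalD D) ∧
    (∃ D : K5MinusEdge.Drawing, D.IsOnePlanarD ∧ ¬IsPlanarMaximalD D) := by
  refine ⟨⟨D₁, ?_, planar_maximal _ D₁_planar⟩, planar_maximal,
    ⟨D₂ _, D₂_onePlanar _, D₂_not_maximal⟩⟩
  intro e
  rw [D₁_planar e]
  exact Set.subsingleton_empty
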